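/- Fix (h♮, m♮) ∈ ℝ^K × ℝ^N with h♮ ≠ 0 and m♮ ≠ 0. Let B ∈ ℝ^{L×K} and C ∈ ℝ^{L×N} have independent standard Gaussian N(0,1) entries, with ℓ-th rows bℓᵀ and cℓᵀ. Let ξ ∈ ℝ^L with ξℓ ∈ [−1, 0] for all ℓ, set ε = ‖ξ‖_∞, yℓ = (bℓᵀh♮)(cℓᵀm♮)(1+ξℓ), and s = sign(Bh♮). There exist absolute constants C₀ > 0 and c > 0 such that if L ≥ C₀(K+N), then with probability at least 1 − e^{−cL}, the minimizer (h*, m*) of the BranchHull program (BH) is unique and satisfies ‖h* − h♮·√(‖m♮‖₂/‖h♮‖₂)‖₂² + ‖m* − m♮·√(‖h♮‖₂/‖m♮‖₂)‖₂² ≤ 4(1 − √(1 − ε))·‖h♮‖₂‖m♮‖₂. -/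

import Mathlib

open MeasureTheory ProbabilityTheory

/-- The product measure on `L × K` real matrices (as functions) with i.i.d. standard
Gaussian `N(0,1)` entries. -/
noncomputable def gaussM (L K : ℕ) : Measure (Fin L → Fin K → ℝ) :=
  Measure.pi fun _ : Fin L => Measure.pi fun _ : Fin K => gaussianReal 0 1

/-- Feasibility for the BranchHull program with data `(B, C, y, s)`. -/
def BHFeas {L K N : ℕ} (B : Fin L → Fin K → ℝ) (C : Fin L → Fin N → ℝ)
    (y s : Fin L → ℝ) (h : EuclideanSpace ℝ (Fin K)) (m : EuclideanSpace ℝ (Fin N)) : Prop :=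
  ∀ ℓ, Real.sign (y ℓ) * ((∑ i, B ℓ i * h i) * (∑ j, C ℓ j * m j)) ≥ |y ℓ| ∧
    s ℓ * (∑ i, B ℓ i * h i) ≥ 0

/-- `(h₀, m₀)` is the unique minimizer of the BranchHull program. -/
def BHUniqueMin {L K N : ℕ} (B : Fin L → Fin K → ℝ) (C : Fin L → Fin N → ℝ)
    (y s : Fin L → ℝ) (h₀ : EuclideanSpace ℝ (Fin K)) (m₀ : EuclideanSpace ℝ (Fin N)) : Prop :=
  BHFeas B C y s h₀ m₀ ∧
    ∀ h m, BHFeas B C y s h m → (h, m) ≠ (h₀, m₀) →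
      ‖h₀‖ ^ 2 + ‖m₀‖ ^ 2 < ‖h‖ ^ 2 + ‖m‖ ^ 2

open Finset in
/-- The sign patterns of finitely many linear functionals on a `d`-dimensional space form a family
of VC dimension at most `d`. -/
theorem vcDim_signPatterns_le {ι V : Type*} [DecidableEq ι] [AddCommGroup V] [Module ℝ V]
    [FiniteDimensional ℝ V] (f : ι → Module.Dual ℝ V) (𝒜 : Finset (Finset ι))
    (h𝒜 : ∀ A ∈ 𝒜, ∃ w, ∀ i, if i ∈ A then 0 < f i w else f i w < 0) :
    𝒜.vcDim ≤ Module.finrank ℝ V := by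
  refine Finset.sup_le fun s hs ↦ ?_
  rw [mem_shatterer] at hs
  by_contra! hcard
  have hdep : ¬ LinearIndepOn ℝ f (s : Set ι) := fun h ↦ by
    have := LinearIndependent.fintype_card_le_finrank h
    simp at this
    omega
  obtain ⟨a, hsum, i₀, hi₀, hne⟩ := not_linearIndepOn_finset_iff.1 hdep
  wlog hpos : 0 < a i₀ generalizing a
  · exact this (-a) (by simp [hsum]) (by simpa using hne)
      (by simpa using lt_of_le_of_ne (not_lt.1 hpos) hne)
  obtain ⟨A, hA, hAs⟩ := hs (filter_subset (fun i ↦ 0 < a i) s)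
  obtain ⟨w, hw⟩ := h𝒜 A hA
  have hmem : ∀ i ∈ s, (i ∈ A ↔ 0 < a i) := fun i hi ↦ by
    have := Finset.ext_iff.1 hAs i
    simpa [hi] using this
  have hzero : ∑ i ∈ s, a i * f i w = 0 := by
    simpa using LinearMap.congr_fun hsum w
  have hterm : ∀ i ∈ s, 0 ≤ a i * f i w := fun i hi ↦ by
    have := hw i
    split_ifs at this with h
    · exact (mul_pos ((hmem i hi).1 h) this).le
    · exact mul_nonneg_of_nonpos_of_nonpos (not_lt.1 (mt (hmem i hi).2 h)) this.le
  have hfi := hw i₀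
  rw [if_pos ((hmem i₀ hi₀).2 hpos)] at hfi
  have := (sum_eq_zero_iff_of_nonneg hterm).1 hzero i₀ hi₀
  exact (mul_pos hpos hfi).ne' this

theorem sum_choose_le {L d : ℕ} (h : 8 * d ≤ L) :
    ((∑ k ∈ Finset.Iic d, L.choose k : ℕ) : ℝ) ≤ (5 / 6) ^ L * 2 ^ L := by
  have h1 : ((∑ k ∈ Finset.Iic d, L.choose k : ℕ) : ℝ) ≤ 2 ^ d * (1 / 2 + 1) ^ L := by
    rw [add_pow, Finset.mul_sum]
    push_cast
    calc ∑ k ∈ Finset.Iic d, (L.choose k : ℝ)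
        ≤ ∑ k ∈ Finset.Iic d, 2 ^ d * ((1 / 2 : ℝ) ^ k * 1 ^ (L - k) * L.choose k) := by
          refine Finset.sum_le_sum fun k hk ↦ ?_
          have : (1 : ℝ) ≤ 2 ^ d * (1 / 2) ^ k := by
            obtain ⟨j, rfl⟩ := Nat.exists_eq_add_of_le (Finset.mem_Iic.1 hk)
            rw [pow_add, mul_right_comm, ← mul_pow]
            norm_num
            exact one_le_pow₀ one_le_two
          rw [one_pow, mul_one, ← mul_assoc]; exact le_mul_of_one_le_left (Nat.cast_nonneg _) this
      _ ≤ _ := by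
          refine Finset.sum_le_sum_of_subset_of_nonneg (fun k hk ↦ ?_) fun _ _ _ ↦ by positivity
          simp at hk ⊢
          omega
  have h2 : (2 : ℝ) ^ d ≤ (10 / 9) ^ L :=
    calc (2 : ℝ) ^ d ≤ ((10 / 9) ^ 8) ^ d := by gcongr; norm_num
      _ = (10 / 9) ^ (8 * d) := by rw [pow_mul]
      _ ≤ _ := pow_le_pow_right₀ (by norm_num) h
  calc _ ≤ _ := h1
    _ ≤ (10 / 9) ^ L * (1 / 2 + 1) ^ L := by gcongr
    _ = _ := by rw [← mul_pow, ← mul_pow]; norm_num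

/-- Few sign patterns of `L` linear functionals on a space of dimension at most `L / 8`
are realised. -/
theorem card_signPatterns_le {L : ℕ} {V : Type*} [AddCommGroup V] [Module ℝ V]
    [FiniteDimensional ℝ V] (hL : 8 * Module.finrank ℝ V ≤ L) (f : Fin L → Module.Dual ℝ V)
    (𝒜 : Finset (Finset (Fin L)))
    (h𝒜 : ∀ A ∈ 𝒜, ∃ w, ∀ i, if i ∈ A then 0 < f i w else f i w < 0) :
    (𝒜.card : ℝ) ≤ (5 / 6) ^ L * 2 ^ L := by
  have h1 := 𝒜.card_le_card_shatterer.trans Finset.card_shatterer_le_sum_vcDim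
  rw [Fintype.card_fin] at h1
  have h2 := vcDim_signPatterns_le f 𝒜 h𝒜
  refine le_trans ?_ (sum_choose_le (L := L) (d := 𝒜.vcDim) (by omega))
  exact_mod_cast h1

/-- Symmetrization: if the signs of `L` random linear functionals on a space of dimension at most
`L / 8` can be flipped individually without changing their law, then it is exponentially unlikely
that they are simultaneously positive somewhere. -/
theorem measure_exists_forall_pos_le {Ω V : Type*} [MeasurableSpace Ω] (μ : Measure Ω)
    [IsProbabilityMeasure μ] [AddCommGroup V] [Module ℝ V] [FiniteDimensional ℝ V] {L : ℕ}
    (hL : 8 * Module.finrank ℝ V ≤ L) (F : Ω → Fin L → Module.Dual ℝ V)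
    (T : Finset (Fin L) → Ω → Ω) (hT : ∀ A, MeasurePreserving (T A) μ μ)
    (hTF : ∀ A ω i, F (T A ω) i = if i ∈ A then F ω i else -F ω i)
    (hmeas : MeasurableSet {ω | ∃ w, ∀ i, 0 < F ω i w}) :
    μ {ω | ∃ w, ∀ i, 0 < F ω i w} ≤ ENNReal.ofReal ((5 / 6) ^ L) := by
  classical
  set S := {ω | ∃ w, ∀ i, 0 < F ω i w}
  have hcount : ∀ ω, ∑ A : Finset (Fin L), (T A ⁻¹' S).indicator 1 ω
      ≤ ENNReal.ofReal ((5 / 6) ^ L * 2 ^ L) := fun ω ↦ by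
    have hcard := card_signPatterns_le hL (F ω) {A | T A ω ∈ S} fun A hA ↦ by
      obtain ⟨w, hw⟩ := (Finset.mem_filter.1 hA).2
      refine ⟨w, fun i ↦ ?_⟩
      have := hw i
      rw [hTF] at this
      split_ifs at this ⊢ with h
      · exact this
      · simpa using this
    refine le_trans (le_of_eq ?_) (ENNReal.ofReal_le_ofReal hcard)
    rw [ENNReal.ofReal_natCast, Finset.card_filter]
    push_cast
    exact Finset.sum_congr rfl fun A _ ↦ by simp [Set.indicator_apply]
  have key : (2 : ENNReal) ^ L * μ S ≤ 2 ^ L * ENNReal.ofReal ((5 / 6) ^ L) :=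
    calc (2 : ENNReal) ^ L * μ S = ∑ A : Finset (Fin L), μ (T A ⁻¹' S) := by
          simp [(hT _).measure_preimage hmeas.nullMeasurableSet]
      _ = ∫⁻ ω, ∑ A : Finset (Fin L), (T A ⁻¹' S).indicator 1 ω ∂μ := by
          rw [lintegral_finsetSum _ fun A _ ↦
            measurable_one.indicator ((hT A).measurable hmeas)]
          exact Finset.sum_congr rfl fun A _ ↦
            (lintegral_indicator_one ((hT A).measurable hmeas)).symm
      _ ≤ ∫⁻ _, ENNReal.ofReal ((5 / 6) ^ L * 2 ^ L) ∂μ := lintegral_mono hcount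
      _ = _ := by
          rw [lintegral_const, measure_univ, mul_one, ENNReal.ofReal_mul (by positivity), mul_comm,
            ENNReal.ofReal_pow zero_le_two, ENNReal.ofReal_ofNat]
  exact (ENNReal.mul_le_mul_iff_right (by simp) (by simp)).1 key

open scoped RealInnerProductSpace

/-- The reflection in the hyperplane orthogonal to `h`. -/
noncomputable abbrev hypReflect {n : ℕ} (h : EuclideanSpace ℝ (Fin n)) :
    EuclideanSpace ℝ (Fin n) ≃ₗᵢ[ℝ] EuclideanSpace ℝ (Fin n) :=
  (ℝ ∙ h)ᗮ.reflection

theorem inner_hypReflect_right {n : ℕ} (h b : EuclideanSpace ℝ (Fin n)) :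
    ⟪h, hypReflect h b⟫ = -⟪h, b⟫ := by
  have := (hypReflect h).inner_map_map h (hypReflect h b)
  rw [Submodule.reflection_reflection, Submodule.reflection_orthogonalComplement_singleton_eq_neg,
    inner_neg_left] at this
  exact this.symm

/-- Twice the component of `b` orthogonal to `h`, normalized by `⟪h, b⟫`. -/
noncomputable def rowSlope {n : ℕ} (h b : EuclideanSpace ℝ (Fin n)) : EuclideanSpace ℝ (Fin n) :=
  ⟪h, b⟫⁻¹ • (b + hypReflect h b)

theorem rowSlope_hypReflect {n : ℕ} (h b : EuclideanSpace ℝ (Fin n)) :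
    rowSlope h (hypReflect h b) = -rowSlope h b := by
  rw [rowSlope, rowSlope, inner_hypReflect_right, Submodule.reflection_reflection, add_comm,
    inv_neg, neg_smul]

theorem measurable_rowSlope {n : ℕ} (h : EuclideanSpace ℝ (Fin n)) : Measurable (rowSlope h) := by
  have : Measurable (hypReflect h) := (hypReflect h).continuous.measurable
  unfold rowSlope
  fun_prop

theorem inner_rowSlope {n : ℕ} {h b : EuclideanSpace ℝ (Fin n)} (hb : ⟪h, b⟫ ≠ 0)
    (p : EuclideanSpace ℝ (Fin n)) :
    ⟪rowSlope h b, p⟫ = 2 * (⟪b, p⟫ / ⟪h, b⟫ - ⟪h, p⟫ / ‖h‖ ^ 2) := by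
  rw [rowSlope, hypReflect, Submodule.reflection_orthogonal_apply,
    Submodule.reflection_singleton_apply, two_smul]
  simp only [inner_smul_left, inner_add_left, inner_neg_left, inner_sub_left, RCLike.conj_to_real]
  simp
  field_simp
  ring

/-- The law of a standard Gaussian row. -/
noncomputable abbrev gaussRow (n : ℕ) : Measure (Fin n → ℝ) :=
  Measure.pi fun _ : Fin n => gaussianReal 0 1

theorem measurePreserving_toLp_gaussRow (n : ℕ) :
    MeasurePreserving (WithLp.toLp 2) (gaussRow n) (stdGaussian (EuclideanSpace ℝ (Fin n))) :=
  ⟨by fun_prop, map_pi_eq_stdGaussian⟩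

theorem measurePreserving_hypReflect_gaussRow {n : ℕ} (h : EuclideanSpace ℝ (Fin n)) :
    MeasurePreserving (fun b ↦ WithLp.ofLp (hypReflect h (WithLp.toLp 2 b))) (gaussRow n)
      (gaussRow n) := by
  have h1 := measurePreserving_toLp_gaussRow n
  have h2 : MeasurePreserving (hypReflect h) (stdGaussian (EuclideanSpace ℝ (Fin n)))
      (stdGaussian _) := ⟨(hypReflect h).continuous.measurable, stdGaussian_map _⟩
  have h3 : MeasurePreserving (WithLp.ofLp) (stdGaussian (EuclideanSpace ℝ (Fin n)))
      (gaussRow n) := ⟨by fun_prop, by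
    rw [← h1.map_eq, Measure.map_map (by fun_prop) (by fun_prop)]
    exact Measure.map_id⟩
  exact h3.comp (h2.comp h1)

theorem gaussRow_inner_eq_zero {n : ℕ} {h : EuclideanSpace ℝ (Fin n)} (hh : h ≠ 0) :
    gaussRow n {b | ⟪h, WithLp.toLp 2 b⟫ = 0} = 0 := by
  have h0 : stdGaussian (EuclideanSpace ℝ (Fin n)) {b | ⟪h, b⟫ = 0} = 0 := by
    have := IsGaussian.map_eq_gaussianReal (μ := stdGaussian (EuclideanSpace ℝ (Fin n)))
      (innerSL ℝ h)
    have hv : (Var[innerSL ℝ h; stdGaussian (EuclideanSpace ℝ (Fin n))]).toNNReal ≠ 0 := by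
      rw [variance_dual_stdGaussian, innerSL_apply_norm]
      simp [hh]
    have hna := nullSingletonClass_gaussianReal
      (μ := (stdGaussian (EuclideanSpace ℝ (Fin n)))[innerSL ℝ h]) hv
    rw [← this] at hna
    have h00 := hna.measure_singleton 0
    rw [Measure.map_apply (by fun_prop) (measurableSet_singleton _)] at h00
    exact h00
  rw [← (measurePreserving_toLp_gaussRow n).map_eq, Measure.map_apply (by fun_prop)
    (measurableSet_eq_fun (by fun_prop) (by fun_prop))] at h0
  exact h0

instance isProbabilityMeasure_gaussM (L n : ℕ) : IsProbabilityMeasure (gaussM L n) := by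
  unfold gaussM
  infer_instance

theorem ae_gaussM_inner_ne_zero (L : ℕ) {n : ℕ} {h : EuclideanSpace ℝ (Fin n)} (hh : h ≠ 0) :
    ∀ᵐ B ∂gaussM L n, ∀ ℓ, ⟪h, WithLp.toLp 2 (B ℓ)⟫ ≠ 0 :=
  ae_all_iff.2 fun ℓ ↦
    (measurePreserving_eval (fun _ : Fin L ↦ gaussRow n) ℓ).quasiMeasurePreserving.ae
      (measure_eq_zero_iff_ae_notMem.1 (gaussRow_inner_eq_zero hh))

/-- Reflect the rows outside `A`. -/
noncomputable def flipRows {L n : ℕ} (h : EuclideanSpace ℝ (Fin n)) (A : Finset (Fin L))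
    (B : Fin L → Fin n → ℝ) : Fin L → Fin n → ℝ :=
  fun ℓ ↦ if ℓ ∈ A then B ℓ else WithLp.ofLp (hypReflect h (WithLp.toLp 2 (B ℓ)))

theorem measurePreserving_flipRows {L n : ℕ} (h : EuclideanSpace ℝ (Fin n))
    (A : Finset (Fin L)) : MeasurePreserving (flipRows h A) (gaussM L n) (gaussM L n) :=
  measurePreserving_pi (fun _ : Fin L ↦ gaussRow n) (fun _ ↦ gaussRow n)
    (f := fun ℓ b ↦ if ℓ ∈ A then b else WithLp.ofLp (hypReflect h (WithLp.toLp 2 b)))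
    fun ℓ ↦ by
      by_cases hℓ : ℓ ∈ A
      · simp only [hℓ, if_true]
        exact MeasurePreserving.id _
      · simpa [hℓ] using measurePreserving_hypReflect_gaussRow h

theorem rowSlope_flipRows {L n : ℕ} (h : EuclideanSpace ℝ (Fin n)) (A : Finset (Fin L))
    (B : Fin L → Fin n → ℝ) (ℓ : Fin L) :
    rowSlope h (WithLp.toLp 2 (flipRows h A B ℓ)) =
      if ℓ ∈ A then rowSlope h (WithLp.toLp 2 (B ℓ)) else -rowSlope h (WithLp.toLp 2 (B ℓ)) := by
  unfold flipRows
  split_ifs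
  · rfl
  · rw [WithLp.toLp_ofLp, rowSlope_hypReflect]

/-- With overwhelming probability the slopes of the rows of `B` and `C` lie in no open
half-space. -/
theorem measure_exists_inner_rowSlope_pos_le {K N L : ℕ} (hL : 8 * (K + N) ≤ L)
    (h : EuclideanSpace ℝ (Fin K)) (m : EuclideanSpace ℝ (Fin N)) :
    ((gaussM L K).prod (gaussM L N))
      {x | ∃ w : EuclideanSpace ℝ (Fin K) × EuclideanSpace ℝ (Fin N), ∀ ℓ,
        0 < ⟪rowSlope h (WithLp.toLp 2 (x.1 ℓ)), w.1⟫ + ⟪rowSlope m (WithLp.toLp 2 (x.2 ℓ)), w.2⟫} ≤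
    ENNReal.ofReal ((5 / 6) ^ L) := by
  let F : (Fin L → Fin K → ℝ) × (Fin L → Fin N → ℝ) → Fin L →
      Module.Dual ℝ (EuclideanSpace ℝ (Fin K) × EuclideanSpace ℝ (Fin N)) := fun x ℓ ↦
    (innerₛₗ ℝ (rowSlope h (WithLp.toLp 2 (x.1 ℓ)))).coprod
      (innerₛₗ ℝ (rowSlope m (WithLp.toLp 2 (x.2 ℓ))))
  have hF : ∀ A x ℓ, F (Prod.map (flipRows h A) (flipRows m A) x) ℓ =
      if ℓ ∈ A then F x ℓ else -F x ℓ := fun A x ℓ ↦ by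
    simp only [F, Prod.map_fst, Prod.map_snd, rowSlope_flipRows]
    split_ifs
    · rfl
    · ext <;> simp
  have hmeas : MeasurableSet {x | ∃ w, ∀ ℓ, 0 < F x ℓ w} := by
    have hopen : IsOpen {v : Fin L → EuclideanSpace ℝ (Fin K) × EuclideanSpace ℝ (Fin N) |
        ∃ w : EuclideanSpace ℝ (Fin K) × EuclideanSpace ℝ (Fin N),
          ∀ ℓ, 0 < ⟪(v ℓ).1, w.1⟫ + ⟪(v ℓ).2, w.2⟫} := by
      simp only [Set.ofPred_exists, Set.ofPred_forall]
      exact isOpen_iUnion fun w ↦ isOpen_iInter_of_finite fun ℓ ↦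
        isOpen_lt continuous_const (by fun_prop)
    have hh := measurable_rowSlope h
    have hm := measurable_rowSlope m
    have hv : Measurable fun (x : (Fin L → Fin K → ℝ) × (Fin L → Fin N → ℝ)) (ℓ : Fin L) ↦
        (rowSlope h (WithLp.toLp 2 (x.1 ℓ)), rowSlope m (WithLp.toLp 2 (x.2 ℓ))) := by fun_prop
    exact hv hopen.measurableSet
  exact measure_exists_forall_pos_le ((gaussM L K).prod (gaussM L N)) (by simpa using hL) F
    (fun A ↦ Prod.map (flipRows h A) (flipRows m A))
    (fun A ↦ (measurePreserving_flipRows h A).prod (measurePreserving_flipRows m A)) hF hmeas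

theorem real_sign_mul_self (x : ℝ) : Real.sign x * x = |x| := by
  rcases lt_trichotomy x 0 with hx | rfl | hx
  · rw [Real.sign_of_neg hx, abs_of_neg hx, neg_one_mul]
  · simp
  · rw [Real.sign_of_pos hx, abs_of_pos hx, one_mul]

theorem real_sign_mul_of_pos (x : ℝ) {t : ℝ} (ht : 0 < t) : Real.sign (x * t) = Real.sign x := by
  rcases lt_trichotomy x 0 with hx | rfl | hx
  · rw [Real.sign_of_neg hx, Real.sign_of_neg (mul_neg_of_neg_of_pos hx ht)]
  · simp
  · rw [Real.sign_of_pos hx, Real.sign_of_pos (mul_pos hx ht)]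

theorem mul_add_ge_of_branch {a b σ s u₁ u₂ v₁ v₂ t : ℝ} (ha : 0 ≤ a) (hb : 0 ≤ b)
    (hab : a + b = 1) (ht : 0 < t) (hs : s ≠ 0) (hu₁ : 0 ≤ s * u₁) (hu₂ : 0 ≤ s * u₂)
    (h₁ : t ≤ σ * (u₁ * v₁)) (h₂ : t ≤ σ * (u₂ * v₂)) :
    t ≤ σ * ((a * u₁ + b * u₂) * (a * v₁ + b * v₂)) := by
  have pos {u v : ℝ} (hu : 0 ≤ s * u) (h : t ≤ σ * (u * v)) : 0 < s * u :=
    hu.lt_of_ne' fun h0 ↦ by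
      rcases mul_eq_zero.1 h0 with h0 | h0
      · exact hs h0
      · simp [h0] at h
        linarith
  have hu₁' := pos hu₁ h₁
  have hu₂' := pos hu₂ h₂
  have hPQ : t ^ 2 ≤ (σ * (u₁ * v₂)) * (σ * (u₂ * v₁)) := by
    calc t ^ 2 = t * t := sq t
      _ ≤ (σ * (u₁ * v₁)) * (σ * (u₂ * v₂)) := mul_le_mul h₁ h₂ ht.le (ht.le.trans h₁)
      _ = _ := by ring
  have hP : 0 < σ * (u₁ * v₂) := by
    have : 0 < (s * u₂) ^ 2 * (σ * (u₁ * v₂)) := by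
      have := mul_pos (mul_pos hu₁' hu₂') (ht.trans_le h₂)
      linarith
    exact pos_of_mul_pos_right this (sq_nonneg _)
  have hQ : 0 < σ * (u₂ * v₁) := pos_of_mul_pos_right ((pow_pos ht 2).trans_le hPQ) hP.le
  have hsum : 2 * t ≤ σ * (u₁ * v₂) + σ * (u₂ * v₁) := by
    refine le_of_sq_le_sq ?_ (by positivity)
    nlinarith [sq_nonneg (σ * (u₁ * v₂) - σ * (u₂ * v₁))]
  calc t = a ^ 2 * t + b ^ 2 * t + a * b * (2 * t) := by
        linear_combination (-t * (a + b + 1)) * hab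
    _ ≤ a ^ 2 * (σ * (u₁ * v₁)) + b ^ 2 * (σ * (u₂ * v₂)) +
        a * b * (σ * (u₁ * v₂) + σ * (u₂ * v₁)) := by gcongr
    _ = _ := by ring

theorem BHFeas.convex_combination {L K N : ℕ} {B : Fin L → Fin K → ℝ} {C : Fin L → Fin N → ℝ}
    {y s : Fin L → ℝ} (hys : ∀ ℓ, y ℓ ≠ 0 → s ℓ ≠ 0) {h₁ h₂ : EuclideanSpace ℝ (Fin K)}
    {m₁ m₂ : EuclideanSpace ℝ (Fin N)} (hf₁ : BHFeas B C y s h₁ m₁) (hf₂ : BHFeas B C y s h₂ m₂)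
    {a b : ℝ} (ha : 0 ≤ a) (hb : 0 ≤ b) (hab : a + b = 1) :
    BHFeas B C y s (a • h₁ + b • h₂) (a • m₁ + b • m₂) := by
  intro ℓ
  obtain ⟨h11, h12⟩ := hf₁ ℓ
  obtain ⟨h21, h22⟩ := hf₂ ℓ
  have lin {n : ℕ} (r : Fin n → ℝ) (p q : EuclideanSpace ℝ (Fin n)) :
      ∑ i, r i * (a • p + b • q) i = a * ∑ i, r i * p i + b * ∑ i, r i * q i := by
    rw [Finset.mul_sum, Finset.mul_sum, ← Finset.sum_add_distrib]
    exact Finset.sum_congr rfl fun i _ ↦ by simp; ring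
  rw [lin, lin]
  constructor
  · by_cases hy : y ℓ = 0
    · simp [hy]
    · exact mul_add_ge_of_branch ha hb hab (abs_pos.2 hy) (hys ℓ hy) h12 h22 h11 h21
  · rw [mul_add, mul_left_comm, mul_left_comm (s ℓ) b]
    exact add_nonneg (mul_nonneg ha h12) (mul_nonneg hb h22)

/-- A feasible BranchHull program has a unique minimizer, characterized by its variational
inequality. -/
theorem exists_BHUniqueMin {L K N : ℕ} {B : Fin L → Fin K → ℝ} {C : Fin L → Fin N → ℝ}
    {y s : Fin L → ℝ} (hys : ∀ ℓ, y ℓ ≠ 0 → s ℓ ≠ 0) {h : EuclideanSpace ℝ (Fin K)}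
    {m : EuclideanSpace ℝ (Fin N)} (hf : BHFeas B C y s h m) :
    ∃ hs ms, BHUniqueMin B C y s hs ms ∧
      ∀ h' m', BHFeas B C y s h' m' → ‖hs‖ ^ 2 + ‖ms‖ ^ 2 ≤ ⟪hs, h'⟫ + ⟪ms, m'⟫ := by
  let S : Set (WithLp 2 (EuclideanSpace ℝ (Fin K) × EuclideanSpace ℝ (Fin N))) :=
    {w | BHFeas B C y s w.fst w.snd}
  have hconv : Convex ℝ S := fun w₁ h₁ w₂ h₂ a b ha hb hab ↦
    BHFeas.convex_combination hys h₁ h₂ ha hb hab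
  have hclosed : IsClosed S := by
    simp only [S, BHFeas, Set.ofPred_forall, Set.ofPred_and, ge_iff_le]
    exact isClosed_iInter fun ℓ ↦ (isClosed_le (by fun_prop) (by fun_prop)).inter
      (isClosed_le (by fun_prop) (by fun_prop))
  obtain ⟨v, hvS, hv⟩ := exists_norm_eq_iInf_of_complete_convex
    ⟨WithLp.toLp 2 (h, m), hf⟩ hclosed.isComplete hconv 0
  rw [norm_eq_iInf_iff_real_inner_le_zero hconv hvS] at hv
  have hvar : ∀ h' m', BHFeas B C y s h' m' →
      ‖v.fst‖ ^ 2 + ‖v.snd‖ ^ 2 ≤ ⟪v.fst, h'⟫ + ⟪v.snd, m'⟫ := fun h' m' hf' ↦ by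
    have := hv (WithLp.toLp 2 (h', m')) hf'
    simp only [zero_sub, inner_neg_left, inner_sub_right, WithLp.prod_inner_apply] at this
    rw [← real_inner_self_eq_norm_sq, ← real_inner_self_eq_norm_sq]
    simp at this ⊢
    linarith
  refine ⟨v.fst, v.snd, ⟨hvS, fun h' m' hf' hne ↦ ?_⟩, hvar⟩
  have h1 := hvar h' m' hf'
  have h2 := norm_sub_sq_real h' v.fst
  have h3 := norm_sub_sq_real m' v.snd
  rw [real_inner_comm] at h2 h3
  have h4 : 0 < ‖h' - v.fst‖ ^ 2 + ‖m' - v.snd‖ ^ 2 := by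
    by_contra! hle
    refine hne (Prod.ext (sub_eq_zero.1 (norm_eq_zero.1 ?_)) (sub_eq_zero.1 (norm_eq_zero.1 ?_)))
    all_goals nlinarith [sq_nonneg ‖h' - v.fst‖, sq_nonneg ‖m' - v.snd‖]
  linarith

/-- Stability of the BranchHull program under one-sided noise, given that the signal satisfies the
optimality condition of the noiseless program. -/
theorem exists_BHUniqueMin_near {L K N : ℕ} {B : Fin L → Fin K → ℝ} {C : Fin L → Fin N → ℝ}
    {h : EuclideanSpace ℝ (Fin K)} {m : EuclideanSpace ℝ (Fin N)} {ξ : Fin L → ℝ}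
    (hξ : ∀ ℓ, ξ ℓ ∈ Set.Icc (-1 : ℝ) 0)
    (hopt : ∀ h' m', BHFeas B C (fun ℓ => (∑ i, B ℓ i * h i) * (∑ j, C ℓ j * m j))
      (fun ℓ => Real.sign (∑ i, B ℓ i * h i)) h' m' →
      ‖h‖ ^ 2 + ‖m‖ ^ 2 ≤ ⟪h, h'⟫ + ⟪m, m'⟫) :
    ∃ hs ms, BHUniqueMin B C
      (fun ℓ => (∑ i, B ℓ i * h i) * (∑ j, C ℓ j * m j) * (1 + ξ ℓ))
      (fun ℓ => Real.sign (∑ i, B ℓ i * h i)) hs ms ∧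
      ‖hs - h‖ ^ 2 + ‖ms - m‖ ^ 2 ≤ 2 * (1 - √(1 - ‖ξ‖)) * (‖h‖ ^ 2 + ‖m‖ ^ 2) := by
  have hξ1 : ‖ξ‖ ≤ 1 := (pi_norm_le_iff_of_nonneg zero_le_one).2 fun ℓ ↦ by
    rw [Real.norm_eq_abs, abs_le]
    exact ⟨(hξ ℓ).1, (hξ ℓ).2.trans zero_le_one⟩
  have hξle : ∀ ℓ, 1 - ‖ξ‖ ≤ 1 + ξ ℓ := fun ℓ ↦ by
    have := norm_le_pi_norm ξ ℓ
    rw [Real.norm_eq_abs] at this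
    linarith [(abs_le.1 this).1]
  have hfeas : BHFeas B C (fun ℓ => (∑ i, B ℓ i * h i) * (∑ j, C ℓ j * m j) * (1 + ξ ℓ))
      (fun ℓ => Real.sign (∑ i, B ℓ i * h i)) h m := fun ℓ ↦ by
    refine ⟨?_, (real_sign_mul_self _).symm ▸ abs_nonneg _⟩
    rcases (show 0 ≤ 1 + ξ ℓ by linarith [(hξ ℓ).1]).eq_or_lt with h0 | h0
    · simp [← h0]
    · simp only
      rw [real_sign_mul_of_pos _ h0, real_sign_mul_self, abs_mul _ (1 + ξ ℓ), abs_of_pos h0]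
      exact mul_le_of_le_one_right (abs_nonneg _) (by linarith [(hξ ℓ).2])
  obtain ⟨hs, ms, hmin, hvar⟩ := exists_BHUniqueMin
    (fun ℓ hy ↦ by
      rw [Ne, Real.sign_eq_zero_iff]
      exact left_ne_zero_of_mul (left_ne_zero_of_mul hy)) hfeas
  refine ⟨hs, ms, hmin, ?_⟩
  have hself := hvar h m hfeas
  have hinner : √(1 - ‖ξ‖) * (‖h‖ ^ 2 + ‖m‖ ^ 2) ≤ ⟪hs, h⟫ + ⟪ms, m⟫ := by
    rcases hξ1.eq_or_lt with h1 | h1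
    · rw [h1, sub_self, Real.sqrt_zero, zero_mul]
      exact le_trans (by positivity) hself
    · have hpos : 0 < 1 - ‖ξ‖ := by linarith
      have hr : 0 < √(1 - ‖ξ‖) := Real.sqrt_pos.2 hpos
      have hscale {n : ℕ} (r : Fin n → ℝ) (p : EuclideanSpace ℝ (Fin n)) :
          ∑ i, r i * ((√(1 - ‖ξ‖))⁻¹ • p) i = (√(1 - ‖ξ‖))⁻¹ * ∑ i, r i * p i := by
        rw [Finset.mul_sum]
        exact Finset.sum_congr rfl fun i _ ↦ by simp; ring
      have := hopt ((√(1 - ‖ξ‖))⁻¹ • hs) ((√(1 - ‖ξ‖))⁻¹ • ms) fun ℓ ↦ by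
        obtain ⟨h2, h3⟩ := hmin.1 ℓ
        simp only at h2 h3 ⊢
        rw [hscale, hscale]
        constructor
        · have h0 : 0 < 1 + ξ ℓ := hpos.trans_le (hξle ℓ)
          rw [real_sign_mul_of_pos _ h0, abs_mul _ (1 + ξ ℓ), abs_of_pos h0] at h2
          rw [mul_mul_mul_comm, ← mul_inv, Real.mul_self_sqrt hpos.le, mul_left_comm, ge_iff_le,
            le_inv_mul_iff₀ hpos, mul_comm]
          exact (mul_le_mul_of_nonneg_left (hξle ℓ) (abs_nonneg _)).trans h2
        · rw [mul_left_comm]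
          exact mul_nonneg (inv_pos.2 hr).le h3
      rw [inner_smul_right, inner_smul_right, ← mul_add, le_inv_mul_iff₀ hr] at this
      rwa [real_inner_comm, real_inner_comm m ms]
  rw [norm_sub_sq_real, norm_sub_sq_real]
  have hle : ‖hs‖ ^ 2 + ‖ms‖ ^ 2 ≤ ‖h‖ ^ 2 + ‖m‖ ^ 2 := by
    by_cases heq : (h, m) = (hs, ms)
    · obtain ⟨rfl, rfl⟩ := Prod.mk.inj heq
      exact le_rfl
    · exact (hmin.2 h m hfeas heq).le
  linarith

/-- If the optimality condition of the noiseless program fails, then the slopes of all rows lie in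
a common open half-space. -/
theorem exists_inner_rowSlope_pos {L K N : ℕ} {B : Fin L → Fin K → ℝ} {C : Fin L → Fin N → ℝ}
    {h : EuclideanSpace ℝ (Fin K)} {m : EuclideanSpace ℝ (Fin N)} (hm : m ≠ 0) (hnorm : ‖h‖ = ‖m‖)
    (hB : ∀ ℓ, ⟪h, WithLp.toLp 2 (B ℓ)⟫ ≠ 0) (hC : ∀ ℓ, ⟪m, WithLp.toLp 2 (C ℓ)⟫ ≠ 0)
    {h' : EuclideanSpace ℝ (Fin K)} {m' : EuclideanSpace ℝ (Fin N)}
    (hf : BHFeas B C (fun ℓ => (∑ i, B ℓ i * h i) * (∑ j, C ℓ j * m j))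
      (fun ℓ => Real.sign (∑ i, B ℓ i * h i)) h' m')
    (hlt : ⟪h, h'⟫ + ⟪m, m'⟫ < ‖h‖ ^ 2 + ‖m‖ ^ 2) (ℓ : Fin L) :
    0 < ⟪rowSlope h (WithLp.toLp 2 (B ℓ)), h'⟫ + ⟪rowSlope m (WithLp.toLp 2 (C ℓ)), m'⟫ := by
  have hsum {n : ℕ} (r : Fin n → ℝ) (p : EuclideanSpace ℝ (Fin n)) :
      ∑ i, r i * p i = ⟪WithLp.toLp 2 r, p⟫ := by
    simp [PiLp.inner_apply, mul_comm]
  obtain ⟨h1, h2⟩ := hf ℓ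
  simp only [hsum] at h1 h2
  rw [real_inner_comm h, real_inner_comm m] at h1
  rw [real_inner_comm h] at h2
  rw [inner_rowSlope (hB ℓ), inner_rowSlope (hC ℓ)]
  have hg := hB ℓ
  have hk := hC ℓ
  have hr : 0 < ‖m‖ ^ 2 := by positivity
  generalize ⟪h, WithLp.toLp 2 (B ℓ)⟫ = g at *
  generalize ⟪m, WithLp.toLp 2 (C ℓ)⟫ = k at *
  obtain ⟨u, hu⟩ : ∃ u, u = ⟪WithLp.toLp 2 (B ℓ), h'⟫ / g := ⟨_, rfl⟩
  obtain ⟨v, hv⟩ : ∃ v, v = ⟪WithLp.toLp 2 (C ℓ), m'⟫ / k := ⟨_, rfl⟩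
  rw [← hu, ← hv]
  rw [eq_div_iff hg] at hu
  rw [eq_div_iff hk] at hv
  rw [← hu, ← hv, mul_mul_mul_comm] at h1
  rw [← hu] at h2
  rw [mul_left_comm, real_sign_mul_self] at h1 h2
  have huv : 1 ≤ u * v := by
    refine le_of_mul_le_mul_right (a := |g * k|) ?_ (by positivity)
    linarith
  have hu0 : 0 ≤ u := nonneg_of_mul_nonneg_left h2 (by positivity)
  have huv2 : 2 ≤ u + v := by
    have : 0 < u := hu0.lt_of_ne fun h ↦ by rw [← h] at huv; linarith
    have : 0 < v := pos_of_mul_pos_right (zero_lt_one.trans_le huv) hu0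
    nlinarith [sq_nonneg (u - v)]
  have hdiv : ⟪h, h'⟫ / ‖h‖ ^ 2 + ⟪m, m'⟫ / ‖m‖ ^ 2 < 2 := by
    rw [hnorm] at hlt ⊢
    rw [← add_div, div_lt_iff₀ hr]
    linarith
  linarith

/-- BranchHull recovery under one-sided noise `ξℓ ∈ [-1,0]`; here `‖ξ‖` is the sup norm
`‖ξ‖_∞ = ε`. -/
theorem stmt15 :
    ∃ C₀ c : ℝ, 0 < C₀ ∧ 0 < c ∧
      ∀ (K N L : ℕ) (h₀ : EuclideanSpace ℝ (Fin K)) (m₀ : EuclideanSpace ℝ (Fin N))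
        (ξ : Fin L → ℝ), h₀ ≠ 0 → m₀ ≠ 0 → (∀ ℓ, ξ ℓ ∈ Set.Icc (-1 : ℝ) 0) →
        C₀ * (K + N) ≤ (L : ℝ) →
        ENNReal.ofReal (1 - Real.exp (-c * L)) ≤
          (Measure.prod (gaussM L K) (gaussM L N))
            {p | ∃ (hs : EuclideanSpace ℝ (Fin K)) (ms : EuclideanSpace ℝ (Fin N)),
              BHUniqueMin p.1 p.2
                (fun ℓ => (∑ i, p.1 ℓ i * h₀ i) * (∑ j, p.2 ℓ j * m₀ j) * (1 + ξ ℓ))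
                (fun ℓ => Real.sign (∑ i, p.1 ℓ i * h₀ i)) hs ms ∧
              ‖hs - Real.sqrt (‖m₀‖ / ‖h₀‖) • h₀‖ ^ 2 +
                  ‖ms - Real.sqrt (‖h₀‖ / ‖m₀‖) • m₀‖ ^ 2 ≤
                4 * (1 - Real.sqrt (1 - ‖ξ‖)) * (‖h₀‖ * ‖m₀‖)} := by
  refine ⟨8, Real.log (6 / 5), by norm_num, Real.log_pos (by norm_num), ?_⟩
  intro K N L h₀ m₀ ξ hh₀ hm₀ hξ hL
  have hL' : 8 * (K + N) ≤ L := by exact_mod_cast hL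
  have hexp : Real.exp (-Real.log (6 / 5) * L) = (5 / 6) ^ L := by
    rw [mul_comm, Real.exp_nat_mul, Real.exp_neg, Real.exp_log (by norm_num)]
    norm_num
  have hhn : 0 < ‖h₀‖ := norm_pos_iff.2 hh₀
  have hmn : 0 < ‖m₀‖ := norm_pos_iff.2 hm₀
  obtain ⟨a, ha⟩ : ∃ a, a = √(‖m₀‖ / ‖h₀‖) := ⟨_, rfl⟩
  obtain ⟨b, hb⟩ : ∃ b, b = √(‖h₀‖ / ‖m₀‖) := ⟨_, rfl⟩
  have ha0 : 0 < a := ha ▸ Real.sqrt_pos.2 (by positivity)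
  have hb0 : 0 < b := hb ▸ Real.sqrt_pos.2 (by positivity)
  have hab : a * b = 1 := by
    rw [ha, hb, ← Real.sqrt_mul (by positivity), div_mul_div_cancel₀ hhn.ne', div_self hmn.ne',
      Real.sqrt_one]
  rw [← ha, ← hb, hexp]
  have hnh : ‖a • h₀‖ ^ 2 = ‖h₀‖ * ‖m₀‖ := by
    rw [norm_smul, Real.norm_of_nonneg ha0.le, mul_pow, ha, Real.sq_sqrt (by positivity)]
    field_simp
  have hnm : ‖b • m₀‖ ^ 2 = ‖h₀‖ * ‖m₀‖ := by
    rw [norm_smul, Real.norm_of_nonneg hb0.le, mul_pow, hb, Real.sq_sqrt (by positivity)]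
    field_simp
  have hnorm : ‖a • h₀‖ = ‖b • m₀‖ :=
    (pow_left_inj₀ (norm_nonneg _) (norm_nonneg _) two_ne_zero).1 (hnh.trans hnm.symm)
  have hah : a • h₀ ≠ 0 := smul_ne_zero ha0.ne' hh₀
  have hbm : b • m₀ ≠ 0 := smul_ne_zero hb0.ne' hm₀
  have hscale {n : ℕ} (r : Fin n → ℝ) (t : ℝ) (p : EuclideanSpace ℝ (Fin n)) :
      ∑ i, r i * (t • p) i = t * ∑ i, r i * p i := by
    rw [Finset.mul_sum]
    exact Finset.sum_congr rfl fun i _ ↦ by simp; ring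
  set G := {p : (Fin L → Fin K → ℝ) × (Fin L → Fin N → ℝ) |
    ∃ (hs : EuclideanSpace ℝ (Fin K)) (ms : EuclideanSpace ℝ (Fin N)),
      BHUniqueMin p.1 p.2
        (fun ℓ => (∑ i, p.1 ℓ i * h₀ i) * (∑ j, p.2 ℓ j * m₀ j) * (1 + ξ ℓ))
        (fun ℓ => Real.sign (∑ i, p.1 ℓ i * h₀ i)) hs ms ∧
      ‖hs - a • h₀‖ ^ 2 + ‖ms - b • m₀‖ ^ 2 ≤
        4 * (1 - Real.sqrt (1 - ‖ξ‖)) * (‖h₀‖ * ‖m₀‖)}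
  have hbad : (gaussM L K).prod (gaussM L N) Gᶜ ≤ ENNReal.ofReal ((5 / 6) ^ L) := by
    refine le_trans (measure_mono_ae ?_)
      (measure_exists_inner_rowSlope_pos_le hL' (a • h₀) (b • m₀))
    filter_upwards [Measure.quasiMeasurePreserving_fst.ae (ae_gaussM_inner_ne_zero L hah),
      Measure.quasiMeasurePreserving_snd.ae (ae_gaussM_inner_ne_zero L hbm)] with p hB hC hp
    by_contra hno
    refine hp ?_
    obtain ⟨hs, ms, hmin, hle⟩ := exists_BHUniqueMin_near (B := p.1) (C := p.2) (h := a • h₀)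
      (m := b • m₀) hξ fun h' m' hf ↦ by
        by_contra! hlt
        exact hno ⟨(h', m'), exists_inner_rowSlope_pos hbm hnorm hB hC hf hlt⟩
    refine ⟨hs, ms, ?_, hle.trans_eq ?_⟩
    · simp only [hscale, mul_mul_mul_comm a, hab, one_mul] at hmin
      simp only [mul_comm a, real_sign_mul_of_pos _ ha0] at hmin
      exact hmin
    · rw [hnh, hnm]
      ring
  rw [ENNReal.ofReal_sub _ (by positivity), ENNReal.ofReal_one, tsub_le_iff_right]
  calc (1 : ENNReal) = (gaussM L K).prod (gaussM L N) (G ∪ Gᶜ) := by simp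
    _ ≤ _ := (measure_union_le _ _).trans (by gcongr)
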